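/- L^p upper bound: for every p ∈ [1, ∞) and every finitely supported complex sequence (a_n)_{n∈ℤ}, ‖ ∑_{n∈ℤ} a_n (ξ_n − σ) ‖_{L^p(ℙ)} ≤ 2√2 · Γ(p/2 + 1)^{1/p} · (∑_{n∈ℤ} |a_n|²)^{1/2}, where Γ is the Gamma function. -/

import Mathlib

open MeasureTheory Complex Filter Finset
open scoped ENNReal

noncomputable def fhat (f : AddCircle (1:ℝ) → ℝ) (k : ℤ) : ℂ :=
  fourierCoeff (fun t => (f t : ℂ)) k

section
open scoped ComplexOrder

lemma aux_hadamard_one {ι : Type*} [Fintype ι] [DecidableEq ι] (A : Matrix ι ι ℂ)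
    (hA : A.PosSemidef) (h1 : ∀ i, A i i = 1) : A.det.re ≤ 1 := by
  have hd := hA.isHermitian.det_eq_prod_eigenvalues
  have ht := hA.isHermitian.trace_eq_sum_eigenvalues
  have ht' : ∑ i, hA.isHermitian.eigenvalues i = Fintype.card ι := by
    have : A.trace = (Fintype.card ι : ℂ) := by simp [Matrix.trace, h1]
    rw [this] at ht
    have h2 := congrArg Complex.re ht
    simpa using h2.symm
  have hd' : A.det.re = ∏ i, hA.isHermitian.eigenvalues i := by
    rw [hd]
    have : (∏ i, ((hA.isHermitian.eigenvalues i : ℝ) : ℂ)) =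
      ((∏ i, hA.isHermitian.eigenvalues i : ℝ) : ℂ) := by push_cast; rfl
    exact (congrArg Complex.re this).trans (Complex.ofReal_re _)
  rw [hd']
  calc ∏ i, hA.isHermitian.eigenvalues i
      ≤ ∏ i, Real.exp (hA.isHermitian.eigenvalues i - 1) := by
        apply Finset.prod_le_prod
        · intro i _; exact hA.eigenvalues_nonneg i
        · intro i _
          have := Real.add_one_le_exp (hA.isHermitian.eigenvalues i - 1)
          linarith
    _ = 1 := by
        rw [← Real.exp_sum, Finset.sum_sub_distrib, ht']; simp

lemma aux_scale_eq {ι : Type*} [Fintype ι] [DecidableEq ι] (A : Matrix ι ι ℂ) (r : ι → ℝ) :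
    (Matrix.of fun i j => (r i : ℂ) * A i j * (r j : ℂ)) =
      Matrix.diagonal (fun i => (r i : ℂ)) * A * Matrix.diagonal (fun i => (r i : ℂ)) := by
  ext i j
  simp [Matrix.mul_diagonal, Matrix.diagonal_mul]

lemma aux_scale {ι : Type*} [Fintype ι] [DecidableEq ι] (A : Matrix ι ι ℂ)
    (hA : A.PosSemidef) (r : ι → ℝ) :
    (Matrix.of fun i j => (r i : ℂ) * A i j * (r j : ℂ)).PosSemidef := by
  have h := hA.conjTranspose_mul_mul_same (Matrix.diagonal (fun i => (r i : ℂ)))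
  rw [aux_scale_eq]
  convert h using 2
  ext i j
  simp [Matrix.diagonal_conjTranspose, Matrix.diagonal_apply]

lemma aux_hadamard {ι : Type*} [Fintype ι] [DecidableEq ι] (A : Matrix ι ι ℂ)
    (hA : A.PosSemidef) (d : ι → ℝ) (hd : ∀ i, 0 < d i) (h1 : ∀ i, A i i = (d i : ℂ)) :
    A.det.re ≤ ∏ i, d i := by
  have h := aux_hadamard_one _ (aux_scale A hA (fun i => (√(d i))⁻¹)) (by
    intro i
    simp only [Matrix.of_apply, h1]
    norm_cast
    have := Real.mul_self_sqrt (hd i).le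
    have h0 := Real.sqrt_pos.2 (hd i)
    field_simp
    nlinarith)
  rw [aux_scale_eq, Matrix.det_mul, Matrix.det_mul, Matrix.det_diagonal] at h
  have hp : (∏ i, (((√(d i))⁻¹ : ℝ) : ℂ)) = ((∏ i, (√(d i))⁻¹ : ℝ) : ℂ) := by push_cast; rfl
  rw [hp] at h
  have h2 : ((∏ i, (√(d i))⁻¹ : ℝ) : ℂ) * A.det * ((∏ i, (√(d i))⁻¹ : ℝ) : ℂ) =
      ((∏ i, (√(d i))⁻¹ * (√(d i))⁻¹ : ℝ) : ℂ) * A.det := by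
    push_cast [Finset.prod_mul_distrib]; ring
  rw [h2, Complex.re_ofReal_mul] at h
  have h3 : ∏ i, ((√(d i))⁻¹ * (√(d i))⁻¹) = (∏ i, d i)⁻¹ := by
    rw [← Finset.prod_inv_distrib]
    refine Finset.prod_congr rfl fun i _ => ?_
    rw [← mul_inv, Real.mul_self_sqrt (hd i).le]
  rw [h3] at h
  have hpos : 0 < ∏ i, d i := Finset.prod_pos fun i _ => hd i
  rwa [inv_mul_le_iff₀ hpos, mul_one] at h

lemma aux_det_expand {ι : Type*} [Fintype ι] [DecidableEq ι] (M : Matrix ι ι ℂ) :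
    (1 + M).det = ∑ s : Finset ι, (M.submatrix (fun i : s => (i : ι)) (fun i : s => (i : ι))).det := by
  have h := (Matrix.detRowAlternating (R := ℂ) (n := ι)).map_add_univ M (1 : Matrix ι ι ℂ)
  rw [add_comm]
  refine h.trans (Finset.sum_congr rfl fun s _ => ?_)
  exact Matrix.det_piecewise_one_eq_submatrix_det M s

lemma aux_fhat_add_one {f : AddCircle (1:ℝ) → ℝ} (hf : Measurable f)
    (hf01 : ∀ t, f t ∈ Set.Icc (0:ℝ) 1) (k : ℤ) :
    fhat (fun t => 1 - f t) k = (if k = 0 then 1 else 0) - fhat f k := by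
  have hint : Integrable (fun t => fourier (-k) t • (f t : ℂ)) AddCircle.haarAddCircle := by
    refine Integrable.of_bound (C := 1) ?_ (ae_of_all _ fun t => ?_)
    · exact ((fourier (-k)).continuous.measurable.smul
        (Complex.measurable_ofReal.comp hf)).aestronglyMeasurable
    · have := hf01 t
      simp only [smul_eq_mul, norm_mul, Complex.norm_real, Real.norm_eq_abs, abs_of_nonneg this.1]
      have h2 : ‖(fourier (-k) t : ℂ)‖ = 1 := by rw [fourier_apply]; exact Circle.norm_coe _
      rw [h2]; linarith [this.2]
  have hint1 : Integrable (fun t => fourier (-k) t • (1 : ℂ)) (AddCircle.haarAddCircle (T := (1:ℝ))) := by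
    refine Integrable.of_bound (C := 1) ?_ (ae_of_all _ fun t => ?_)
    · exact ((fourier (-k)).continuous.measurable.smul
        measurable_const).aestronglyMeasurable
    · rw [fourier_apply, norm_smul, Circle.norm_coe]; simp
  have h1 : ∫ t, fourier (-k) t • (1 : ℂ) ∂(AddCircle.haarAddCircle (T := (1:ℝ))) =
      if k = 0 then 1 else 0 := by
    have h := congrFun (fourierCoeff_fourier (T := (1:ℝ)) 0) k
    rw [Pi.single_apply] at h
    rw [← h, fourierCoeff]
    congr 1
    ext t
    rw [fourier_zero]
  unfold fhat fourierCoeff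
  rw [← h1, ← integral_sub hint1 hint]
  congr 1
  ext t
  simp [mul_sub]

lemma aux_psd {g : AddCircle (1:ℝ) → ℝ} (hg : Measurable g)
    (hg01 : ∀ t, g t ∈ Set.Icc (0:ℝ) 1) {ι : Type*} [Fintype ι] (n : ι → ℤ) :
    (Matrix.of fun i j => fhat g (n i - n j)).PosSemidef := by
  have hint : ∀ k : ℤ, Integrable (fun t => fourier (-k) t • (g t : ℂ)) AddCircle.haarAddCircle := by
    intro k
    refine Integrable.of_bound (C := 1) ?_ (ae_of_all _ fun t => ?_)
    · exact ((fourier (-k)).continuous.measurable.smul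
        (Complex.measurable_ofReal.comp hg)).aestronglyMeasurable
    · have := hg01 t
      simp only [smul_eq_mul, norm_mul, Complex.norm_real, Real.norm_eq_abs, abs_of_nonneg this.1]
      have h2 : ‖(fourier (-k) t : ℂ)‖ = 1 := by rw [fourier_apply]; exact Circle.norm_coe _
      rw [h2]; linarith [this.2]
  refine Matrix.PosSemidef.of_dotProduct_mulVec_nonneg ?_ fun x => ?_
  · ext i j
    simp only [Matrix.conjTranspose_apply, Matrix.of_apply, fhat, fourierCoeff, RCLike.star_def]
    rw [← integral_conj]
    congr 1
    ext t
    simp only [smul_eq_mul, map_mul, Complex.conj_ofReal, ← fourier_neg]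
    congr 3
    ring_nf
  · have key : star x ⬝ᵥ ((Matrix.of fun i j => fhat g (n i - n j)).mulVec x) =
        ((∫ t, g t * ‖∑ j, x j * fourier (n j) t‖ ^ 2 ∂AddCircle.haarAddCircle : ℝ) : ℂ) := by
      refine Eq.trans ?_ (integral_complex_ofReal (f := fun t => g t * ‖∑ j, x j * fourier (n j) t‖ ^ 2))
      simp only [dotProduct, Matrix.mulVec, Matrix.of_apply, fhat, fourierCoeff, Finset.mul_sum,
        Pi.star_apply, RCLike.star_def]
      simp_rw [← integral_mul_const, ← integral_const_mul]
      have hint2 : ∀ i j, Integrable (fun t => (starRingEnd ℂ) (x i) *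
          (fourier (-(n i - n j)) t • (g t : ℂ) * x j)) AddCircle.haarAddCircle :=
        fun i j => ((hint _).mul_const _).const_mul _
      have e1 : ∀ i, ∑ j, ∫ t, (starRingEnd ℂ) (x i) *
          (fourier (-(n i - n j)) t • (g t : ℂ) * x j) ∂AddCircle.haarAddCircle =
          ∫ t, ∑ j, (starRingEnd ℂ) (x i) *
          (fourier (-(n i - n j)) t • (g t : ℂ) * x j) ∂AddCircle.haarAddCircle := by
        intro i
        rw [integral_finsetSum _ (fun j _ => hint2 i j)]
      simp_rw [e1]
      rw [← integral_finsetSum _ (fun i _ => integrable_finsetSum _ fun j _ => hint2 i j)]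
      congr 1
      ext t
      have h3 : ((g t * ‖∑ j, x j * fourier (n j) t‖ ^ 2 : ℝ) : ℂ) =
          (g t : ℂ) * ((starRingEnd ℂ) (∑ j, x j * fourier (n j) t) *
            (∑ j, x j * fourier (n j) t)) := by
        rw [Complex.conj_mul']
        push_cast; rfl
      refine Eq.trans ?_ h3.symm
      rw [map_sum, Finset.sum_mul_sum, Finset.mul_sum]
      refine Finset.sum_congr rfl fun i _ => ?_
      rw [Finset.mul_sum]
      refine Finset.sum_congr rfl fun j _ => ?_
      rw [map_mul, ← fourier_neg, neg_sub, sub_eq_add_neg, fourier_add]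
      simp only [smul_eq_mul]
      ring
    rw [key]
    rw [Complex.zero_le_real]
    exact integral_nonneg fun t => mul_nonneg (hg01 t).1 (by positivity)

end

section
open scoped ComplexOrder

lemma aux_dpp {f : AddCircle (1:ℝ) → ℝ}
    {Ω : Type*} [MeasurableSpace Ω] {P : Measure Ω}
    {ξ : ℤ → Ω → ℝ}
    (hDPP : ∀ (k : ℕ) (n : Fin k → ℤ), Function.Injective n →
      ((∫ ω, ∏ i, ξ (n i) ω ∂P : ℝ) : ℂ) =
        Matrix.det (Matrix.of fun i j => fhat f (n i - n j)))
    {ι : Type*} [Fintype ι] [DecidableEq ι] (n : ι → ℤ) (hn : Function.Injective n) :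
    ((∫ ω, ∏ i, ξ (n i) ω ∂P : ℝ) : ℂ) =
        Matrix.det (Matrix.of fun i j => fhat f (n i - n j)) := by
  let e := Fintype.equivFin ι
  have h := hDPP _ (fun i => n (e.symm i)) (hn.comp e.symm.injective)
  have h1 : ∀ ω, ∏ i, ξ (n (e.symm i)) ω = ∏ i, ξ (n i) ω := fun ω =>
    e.symm.prod_comp (fun i => ξ (n i) ω)
  simp_rw [h1] at h
  rw [h, ← Matrix.det_submatrix_equiv_self e.symm]
  rfl

lemma aux_expect {f : AddCircle (1:ℝ) → ℝ}
    {Ω : Type*} [MeasurableSpace Ω] {P : Measure Ω} [IsProbabilityMeasure P]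
    {ξ : ℤ → Ω → ℝ} (hξ_meas : ∀ n, Measurable (ξ n))
    (hξ01 : ∀ n ω, ξ n ω = 0 ∨ ξ n ω = 1)
    (hDPP : ∀ (k : ℕ) (n : Fin k → ℤ), Function.Injective n →
      ((∫ ω, ∏ i, ξ (n i) ω ∂P : ℝ) : ℂ) =
        Matrix.det (Matrix.of fun i j => fhat f (n i - n j)))
    {ι : Type*} [Fintype ι] [DecidableEq ι] (n : ι → ℤ) (hn : Function.Injective n)
    (u v : ι → ℝ) :
    ((∫ ω, ∏ i, (1 + u i * v i * ξ (n i) ω) ∂P : ℝ) : ℂ) =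
      (1 + Matrix.of fun i j => (u i : ℂ) * fhat f (n i - n j) * (v j : ℂ)).det := by
  rw [aux_det_expand]
  simp_rw [Finset.prod_one_add]
  have hint : ∀ T : Finset ι, Integrable (fun ω => ∏ i ∈ T, (u i * v i * ξ (n i) ω)) P := by
    intro T
    simp_rw [Finset.prod_mul_distrib]
    refine Integrable.const_mul ?_ _
    refine Integrable.of_bound (C := 1) ?_ (ae_of_all _ fun ω => ?_)
    · exact (Finset.measurable_prod _ fun i _ => hξ_meas _).aestronglyMeasurable
    · rw [Real.norm_eq_abs, Finset.abs_prod]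
      refine Finset.prod_le_one (fun _ _ => abs_nonneg _) fun i _ => ?_
      rcases hξ01 (n i) ω with h | h <;> simp [h]
  rw [integral_finsetSum _ (fun T _ => hint T)]
  rw [Finset.powerset_univ]
  push_cast
  refine Finset.sum_congr rfl fun T _ => ?_
  have h := aux_dpp hDPP (fun i : T => n i) (hn.comp Subtype.val_injective)
  have h1 : ∀ ω, ∏ i ∈ T, (u i * v i * ξ (n i) ω) =
      (∏ i : T, u i) * (∏ i : T, v i) * ∏ i : T, ξ (n i) ω := by
    intro ω
    rw [← Finset.prod_coe_sort, Finset.prod_mul_distrib, Finset.prod_mul_distrib]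
  simp_rw [h1]
  rw [integral_const_mul]
  push_cast
  rw [h]
  have h2 : (Matrix.of fun i j => (u i : ℂ) * fhat f (n i - n j) * (v j : ℂ)).submatrix
      (fun i : T => (i : ι)) (fun i : T => (i : ι)) =
      Matrix.diagonal (fun i : T => (u i : ℂ)) *
        (Matrix.of fun i j : T => fhat f (n i - n j)) * Matrix.diagonal (fun i : T => (v i : ℂ)) := by
    ext i j
    simp [Matrix.mul_diagonal, Matrix.diagonal_mul]
  rw [h2, Matrix.det_mul, Matrix.det_mul, Matrix.det_diagonal, Matrix.det_diagonal]
  ring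

lemma aux_fhat_zero (f : AddCircle (1:ℝ) → ℝ) :
    fhat f 0 = ((∫ t, f t ∂AddCircle.haarAddCircle : ℝ) : ℂ) := by
  rw [fhat, fourierCoeff]
  refine Eq.trans ?_ (integral_complex_ofReal (f := f))
  congr 1
  ext t
  simp

lemma aux_exp_le {f : AddCircle (1:ℝ) → ℝ} (hf_meas : Measurable f)
    (hf01 : ∀ t, f t ∈ Set.Icc (0:ℝ) 1)
    {σ : ℝ} (hσ : σ = ∫ t, f t ∂AddCircle.haarAddCircle)
    (hσ0 : 0 < σ) (hσ1 : σ < 1)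
    {Ω : Type*} [MeasurableSpace Ω] {P : Measure Ω} [IsProbabilityMeasure P]
    {ξ : ℤ → Ω → ℝ} (hξ_meas : ∀ n, Measurable (ξ n))
    (hξ01 : ∀ n ω, ξ n ω = 0 ∨ ξ n ω = 1)
    (hDPP : ∀ (k : ℕ) (n : Fin k → ℤ), Function.Injective n →
      ((∫ ω, ∏ i, ξ (n i) ω ∂P : ℝ) : ℂ) =
        Matrix.det (Matrix.of fun i j => fhat f (n i - n j)))
    {ι : Type*} [Fintype ι] [DecidableEq ι] (n : ι → ℤ) (hn : Function.Injective n)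
    (w : ι → ℝ) (hw : (∀ i, 0 ≤ w i) ∨ (∀ i, w i ≤ 0)) :
    ∫ ω, Real.exp (∑ i, w i * ξ (n i) ω) ∂P ≤ ∏ i, (1 + (Real.exp (w i) - 1) * σ) := by
  have h1 : ∀ ω, Real.exp (∑ i, w i * ξ (n i) ω) =
      ∏ i, (1 + (Real.exp (w i) - 1) * ξ (n i) ω) := by
    intro ω
    rw [Real.exp_sum]
    refine Finset.prod_congr rfl fun i _ => ?_
    rcases hξ01 (n i) ω with h | h <;> simp [h]
  simp_rw [h1]
  have hpos : ∀ i, 0 < 1 + (Real.exp (w i) - 1) * σ := by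
    intro i
    nlinarith [Real.exp_pos (w i)]
  have h0 : fhat f 0 = (σ : ℂ) := by rw [aux_fhat_zero, hσ]
  have hK := aux_psd hf_meas hf01 n
  have hK' : (1 - Matrix.of fun i j => fhat f (n i - n j)).PosSemidef := by
    have h := aux_psd (g := fun t => 1 - f t) (measurable_const.sub hf_meas)
      (fun t => ⟨by linarith [(hf01 t).2], by linarith [(hf01 t).1]⟩) n
    convert h using 1
    ext i j
    simp only [Matrix.sub_apply, Matrix.of_apply, aux_fhat_add_one hf_meas hf01, Matrix.one_apply,
      sub_eq_zero, hn.eq_iff]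
  rcases hw with hw | hw
  · have hE : ∀ i, 0 ≤ Real.exp (w i) - 1 := fun i => by
      have := Real.one_le_exp (hw i); linarith
    set r : ι → ℝ := fun i => √(Real.exp (w i) - 1) with hr
    have hrr : ∀ i, r i * r i = Real.exp (w i) - 1 := fun i => Real.mul_self_sqrt (hE i)
    have h := aux_expect hξ_meas hξ01 hDPP n hn r r
    simp_rw [hrr] at h
    have h2 := aux_hadamard _ (Matrix.PosSemidef.one.add (aux_scale _ hK r)) _ hpos (by
      intro i
      simp only [Matrix.add_apply, Matrix.one_apply_eq, Matrix.of_apply, sub_self, h0]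
      rw [← hrr]; push_cast; ring)
    refine le_trans (le_of_eq ?_) h2
    have h3 := congrArg Complex.re h
    rw [Complex.ofReal_re] at h3
    exact h3
  · have hE : ∀ i, 0 ≤ 1 - Real.exp (w i) := fun i => by
      have := Real.exp_le_one_iff.2 (hw i); linarith
    set r : ι → ℝ := fun i => √(1 - Real.exp (w i)) with hr
    have hrr : ∀ i, r i * r i = 1 - Real.exp (w i) := fun i => Real.mul_self_sqrt (hE i)
    have h := aux_expect hξ_meas hξ01 hDPP n hn (fun i => - r i) r
    have hnr : ∀ i, -r i * r i = Real.exp (w i) - 1 := fun i => by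
      rw [neg_mul, hrr, neg_sub]
    simp_rw [hnr] at h
    have hD : (Matrix.diagonal fun i => ((Real.exp (w i) : ℝ) : ℂ)).PosSemidef := by
      refine Matrix.PosSemidef.diagonal fun i => ?_
      exact Complex.zero_le_real.2 (Real.exp_pos _).le
    have h2 := aux_hadamard _ (hD.add (aux_scale _ hK' r)) _ hpos (by
      intro i
      simp only [Matrix.add_apply, Matrix.one_apply_eq, Matrix.of_apply, sub_self, h0,
        Matrix.sub_apply, Matrix.diagonal_apply_eq]
      have : Real.exp (w i) = 1 - r i * r i := by rw [hrr]; ring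
      rw [this]; push_cast; ring)
    refine le_trans (le_of_eq ?_) h2
    have h3 := congrArg Complex.re h
    rw [Complex.ofReal_re] at h3
    rw [h3]
    congr 2
    ext i j
    by_cases hij : i = j
    · subst hij
      simp only [Matrix.add_apply, Matrix.one_apply_eq, Matrix.of_apply,
        Matrix.sub_apply, Matrix.diagonal_apply_eq]
      have : Real.exp (w i) = 1 - r i * r i := by rw [hrr]; ring
      rw [this]; push_cast; ring
    · simp [hij]

end

lemma aux_subG {f : AddCircle (1:ℝ) → ℝ} (hf_meas : Measurable f)
    (hf01 : ∀ t, f t ∈ Set.Icc (0:ℝ) 1)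
    {σ : ℝ} (hσ : σ = ∫ t, f t ∂AddCircle.haarAddCircle)
    (hσ0 : 0 < σ) (hσ1 : σ < 1)
    {Ω : Type*} [MeasurableSpace Ω] {P : Measure Ω} [IsProbabilityMeasure P]
    {ξ : ℤ → Ω → ℝ} (hξ_meas : ∀ n, Measurable (ξ n))
    (hξ01 : ∀ n ω, ξ n ω = 0 ∨ ξ n ω = 1)
    (hDPP : ∀ (k : ℕ) (n : Fin k → ℤ), Function.Injective n →
      ((∫ ω, ∏ i, ξ (n i) ω ∂P : ℝ) : ℂ) =
        Matrix.det (Matrix.of fun i j => fhat f (n i - n j)))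
    (S : Finset ℤ) (w : ℤ → ℝ) (hw : (∀ i, 0 ≤ w i) ∨ (∀ i, w i ≤ 0)) :
    ProbabilityTheory.HasSubgaussianMGF (fun ω => ∑ i ∈ S, w i * (ξ i ω - σ))
      (∑ i ∈ S, w i ^ 2 / 4).toNNReal P := by
  have hb : ∀ i ω, ξ i ω ∈ Set.Icc (0:ℝ) 1 := fun i ω => by
    rcases hξ01 i ω with h | h <;> simp [h]
  have hint1 : ∀ i, Integrable (ξ i) P := fun i =>
    Integrable.of_bound (C := 1) (hξ_meas i).aestronglyMeasurable (ae_of_all _ fun ω => by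
      rcases hξ01 i ω with h | h <;> simp [h])
  have hmean : ∀ i, ∫ ω, ξ i ω ∂P = σ := by
    intro i
    have h := hDPP 1 (fun _ => i) (fun _ _ _ => Subsingleton.elim _ _)
    simp only [Finset.univ_unique, Finset.prod_singleton, Matrix.det_unique, Matrix.of_apply,
      sub_self, aux_fhat_zero, ← hσ] at h
    exact_mod_cast h
  have hoeff : ∀ (i : ℤ) (t : ℝ), 1 + (Real.exp t - 1) * σ ≤ Real.exp (t * σ + t ^ 2 / 8) := by
    intro i t
    have h := (ProbabilityTheory.hasSubgaussianMGF_of_mem_Icc (μ := P) (hξ_meas i).aemeasurable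
      (ae_of_all _ (hb i))).mgf_le t
    rw [hmean, ProbabilityTheory.mgf] at h
    have h1 : ∀ ω, Real.exp (t * (ξ i ω - σ)) =
        Real.exp (-(t * σ)) * (1 + (Real.exp t - 1) * ξ i ω) := by
      intro ω
      rcases hξ01 i ω with h | h
      · simp [h]
      · simp only [h]; rw [mul_one, add_sub_cancel, ← Real.exp_add]; ring_nf
    simp_rw [h1] at h
    rw [integral_const_mul, integral_add (integrable_const _) ((hint1 i).const_mul _),
      integral_const_mul, hmean] at h
    have h2 : Real.exp (t * σ + t ^ 2 / 8) = Real.exp (t * σ) * Real.exp (t ^ 2 / 8) := by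
      rw [Real.exp_add]
    have h3 : (Real.exp (-(t * σ))) * Real.exp (t * σ) = 1 := by
      rw [← Real.exp_add]; simp
    have h4 : ((((‖(1:ℝ) - 0‖₊ / 2) ^ 2 : NNReal) : ℝ) * t ^ 2 / 2) = t ^ 2 / 8 := by
      simp; ring
    rw [h4] at h
    simp only [integral_const, probReal_univ, smul_eq_mul, mul_one] at h
    rw [h2]
    calc 1 + (Real.exp t - 1) * σ
        = Real.exp (t * σ) * (Real.exp (-(t * σ)) * (1 + (Real.exp t - 1) * σ)) := by
          rw [← mul_assoc, mul_comm (Real.exp (t * σ)), h3, one_mul]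
      _ ≤ _ := mul_le_mul_of_nonneg_left h (Real.exp_pos _).le
  have hmeasX : Measurable (fun ω => ∑ i ∈ S, w i * (ξ i ω - σ)) :=
    Finset.measurable_sum _ fun i _ => ((hξ_meas i).sub_const σ).const_mul _
  refine ⟨fun t => ?_, fun t => ?_⟩
  · refine Integrable.of_bound (C := Real.exp (∑ i ∈ S, |t| * |w i|))
      (Real.measurable_exp.comp (hmeasX.const_mul t)).aestronglyMeasurable
      (ae_of_all _ fun ω => ?_)
    rw [Real.norm_eq_abs, Real.abs_exp, Real.exp_le_exp, Finset.mul_sum]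
    refine Finset.sum_le_sum fun i _ => ?_
    have h1 : |ξ i ω - σ| ≤ 1 := by
      have := hb i ω
      rw [abs_le]; constructor <;> linarith [this.1, this.2]
    calc t * (w i * (ξ i ω - σ)) ≤ |t * (w i * (ξ i ω - σ))| := le_abs_self _
      _ = |t| * |w i| * |ξ i ω - σ| := by rw [abs_mul, abs_mul]; ring
      _ ≤ |t| * |w i| * 1 := by gcongr
      _ = _ := mul_one _
  · rw [ProbabilityTheory.mgf, Real.coe_toNNReal _ (Finset.sum_nonneg fun i _ => by positivity)]
    have hw' : (∀ i : S, 0 ≤ t * w i) ∨ (∀ i : S, t * w i ≤ 0) := by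
      rcases le_total 0 t with ht | ht <;> rcases hw with h | h
      · exact Or.inl fun i => mul_nonneg ht (h i)
      · exact Or.inr fun i => mul_nonpos_of_nonneg_of_nonpos ht (h i)
      · exact Or.inr fun i => mul_nonpos_of_nonpos_of_nonneg ht (h i)
      · exact Or.inl fun i => mul_nonneg_of_nonpos_of_nonpos ht (h i)
    have h := aux_exp_le hf_meas hf01 hσ hσ0 hσ1 hξ_meas hξ01 hDPP (fun i : S => (i : ℤ))
      Subtype.val_injective (fun i => t * w i) hw'
    have e1 : ∀ ω, Real.exp (t * ∑ i ∈ S, w i * (ξ i ω - σ)) =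
        Real.exp (-(∑ i : S, t * w i * σ)) * Real.exp (∑ i : S, t * w i * ξ i ω) := by
      intro ω
      rw [← Real.exp_add, ← Finset.sum_coe_sort, Finset.mul_sum, ← Finset.sum_neg_distrib,
        ← Finset.sum_add_distrib]
      congr 1
      refine Finset.sum_congr rfl fun i _ => ?_
      ring
    simp_rw [e1]
    rw [integral_const_mul]
    calc _ ≤ Real.exp (-(∑ i : S, t * w i * σ)) *
          ∏ i : S, Real.exp (t * w i * σ + (t * w i) ^ 2 / 8) := by
          refine mul_le_mul_of_nonneg_left (h.trans ?_) (Real.exp_pos _).le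
          refine Finset.prod_le_prod (fun i _ => ?_) fun i _ => hoeff i _
          nlinarith [Real.exp_pos (t * w i)]
      _ = _ := by
          rw [← Real.exp_sum, ← Real.exp_add, ← Finset.sum_coe_sort S]
          congr 1
          rw [← Finset.sum_neg_distrib, ← Finset.sum_add_distrib, Finset.sum_mul, Finset.sum_div]
          refine Finset.sum_congr rfl fun i _ => ?_
          ring

lemma aux_moment {Ω : Type*} [MeasurableSpace Ω] {P : Measure Ω} [IsProbabilityMeasure P]
    {X : Ω → ℝ} {c : NNReal} (hc : 0 < c) (h : ProbabilityTheory.HasSubgaussianMGF X c P)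
    {p : ℝ} (hp : 1 ≤ p) :
    ∫⁻ ω, ENNReal.ofReal (|X ω| ^ p) ∂P ≤
      ENNReal.ofReal (2 * (2 * (c:ℝ)) ^ (p / 2) * Real.Gamma (p / 2 + 1)) := by
  have hp0 : 0 < p := by linarith
  have hc' : (0:ℝ) < c := hc
  rw [lintegral_rpow_eq_lintegral_meas_le_mul P (ae_of_all _ fun ω => abs_nonneg _)
    (measurable_norm.comp_aemeasurable h.aemeasurable) hp0]
  have htail : ∀ t : ℝ, 0 < t → P {ω | t ≤ |X ω|} ≤
      ENNReal.ofReal (2 * Real.exp (-(1 / (2 * (c:ℝ))) * t ^ (2:ℝ))) := by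
    intro t ht
    have h1 := h.measure_ge_le ht.le
    have h2 := h.neg.measure_ge_le ht.le
    have hsub : {ω | t ≤ |X ω|} ⊆ {ω | t ≤ X ω} ∪ {ω | t ≤ (-X) ω} := by
      intro ω hω
      have hω' : t ≤ |X ω| := hω
      exact le_abs.1 hω'
    have e : -(1 / (2 * (c:ℝ))) * t ^ (2:ℝ) = -t ^ 2 / (2 * c) := by
      rw [Real.rpow_two]; ring
    rw [e]
    have h3 : P.real {ω | t ≤ |X ω|} ≤ 2 * Real.exp (-t ^ 2 / (2 * c)) := by
      calc _ ≤ P.real ({ω | t ≤ X ω} ∪ {ω | t ≤ (-X) ω}) := measureReal_mono hsub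
        _ ≤ _ := measureReal_union_le _ _
        _ ≤ _ := by linarith
    rw [← ofReal_measureReal]
    exact ENNReal.ofReal_le_ofReal h3
  have hint := _root_.integral_rpow_mul_exp_neg_mul_rpow (p := 2) (q := p - 1) (b := 1 / (2 * (c:ℝ)))
    (by norm_num) (by linarith) (by positivity)
  have hI : IntegrableOn (fun x : ℝ => x ^ (p - 1) * Real.exp (-(1 / (2 * (c:ℝ))) * x ^ (2:ℝ)))
      (Set.Ioi 0) := by
    simpa using integrableOn_rpow_mul_exp_neg_mul_rpow (p := 2) (s := p - 1) (b := 1 / (2 * (c:ℝ)))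
      (by linarith) (by norm_num) (by positivity)
  calc _ ≤ ENNReal.ofReal p * ∫⁻ t in Set.Ioi (0:ℝ),
        ENNReal.ofReal (2 * (t ^ (p - 1) * Real.exp (-(1 / (2 * (c:ℝ))) * t ^ (2:ℝ)))) := by
        refine mul_le_mul_right ?_ _
        refine setLIntegral_mono' measurableSet_Ioi fun t ht => ?_
        have ht' : (0:ℝ) < t := ht
        calc _ ≤ ENNReal.ofReal (2 * Real.exp (-(1 / (2 * (c:ℝ))) * t ^ (2:ℝ))) *
              ENNReal.ofReal (t ^ (p - 1)) := by
              gcongr; exact htail t ht'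
          _ = _ := by
              rw [← ENNReal.ofReal_mul (by positivity)]
              congr 1; ring
    _ = ENNReal.ofReal p * ENNReal.ofReal (∫ t in Set.Ioi (0:ℝ),
          2 * (t ^ (p - 1) * Real.exp (-(1 / (2 * (c:ℝ))) * t ^ (2:ℝ)))) := by
        rw [ofReal_integral_eq_lintegral_ofReal (hI.const_mul 2)]
        refine (ae_restrict_iff' measurableSet_Ioi).2 (ae_of_all _ fun t ht => ?_)
        have ht' : (0:ℝ) < t := ht
        simp only [Pi.zero_apply]
        positivity
    _ = _ := by
        rw [integral_const_mul, hint, ← ENNReal.ofReal_mul hp0.le]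
        congr 1
        have e1 : (1 / (2 * (c:ℝ))) ^ (-(p - 1 + 1) / 2) = (2 * (c:ℝ)) ^ (p / 2) := by
          rw [one_div, Real.inv_rpow (by positivity), ← Real.rpow_neg (by positivity)]
          congr 1; ring
        rw [e1, Real.Gamma_add_one (by positivity)]
        have e2 : (p - 1 + 1) / 2 = p / 2 := by ring
        rw [e2]; ring

lemma aux_norm {Ω : Type*} [MeasurableSpace Ω] {P : Measure Ω} [IsProbabilityMeasure P]
    {X : Ω → ℝ} {c : NNReal} (h : ProbabilityTheory.HasSubgaussianMGF X c P)
    {p : ℝ} (hp : 1 ≤ p) :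
    eLpNorm X (ENNReal.ofReal p) P ≤
      ENNReal.ofReal (2 * Real.Gamma (p / 2 + 1) ^ (1 / p) * √(2 * c)) := by
  have hp0 : 0 < p := by linarith
  rcases eq_or_ne c 0 with rfl | hc
  · have h0 := h.ae_eq_zero_of_hasSubgaussianMGF_zero
    rw [eLpNorm_congr_ae h0]
    simp
  have hc' : 0 < c := pos_iff_ne_zero.2 hc
  have hc'' : (0:ℝ) < c := hc'
  have hG : 0 < Real.Gamma (p / 2 + 1) := Real.Gamma_pos_of_pos (by positivity)
  rw [eLpNorm_eq_lintegral_rpow_enorm_toReal (by simpa using hp0) ENNReal.ofReal_ne_top,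
    ENNReal.toReal_ofReal hp0.le]
  have e : ∀ ω, ‖X ω‖ₑ ^ p = ENNReal.ofReal (|X ω| ^ p) := fun ω => by
    rw [← Real.norm_eq_abs, ← ENNReal.ofReal_rpow_of_nonneg (norm_nonneg _) hp0.le,
      ofReal_norm]
  simp_rw [e]
  calc _ ≤ (ENNReal.ofReal (2 * (2 * (c:ℝ)) ^ (p / 2) * Real.Gamma (p / 2 + 1))) ^ (1 / p) :=
        ENNReal.rpow_le_rpow (aux_moment hc' h hp) (by positivity)
    _ = ENNReal.ofReal ((2 * (2 * (c:ℝ)) ^ (p / 2) * Real.Gamma (p / 2 + 1)) ^ (1 / p)) :=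
        ENNReal.ofReal_rpow_of_nonneg (by positivity) (by positivity)
    _ ≤ _ := by
        apply ENNReal.ofReal_le_ofReal
        rw [Real.mul_rpow (by positivity) hG.le, Real.mul_rpow (by positivity) (by positivity),
          ← Real.rpow_mul (by positivity), Real.sqrt_eq_rpow]
        have e1 : p / 2 * (1 / p) = 1 / 2 := by field_simp
        rw [e1]
        have e2 : (2:ℝ) ^ (1 / p) ≤ 2 := by
          calc (2:ℝ) ^ (1 / p) ≤ (2:ℝ) ^ (1:ℝ) := by
                apply Real.rpow_le_rpow_of_exponent_le (by norm_num)
                rw [div_le_one hp0]; exact hp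
            _ = 2 := Real.rpow_one _
        have h3 : 0 ≤ (2 * (c:ℝ)) ^ ((1:ℝ) / 2) * Real.Gamma (p / 2 + 1) ^ (1 / p) := by positivity
        nlinarith

lemma aux_real {f : AddCircle (1:ℝ) → ℝ} (hf_meas : Measurable f)
    (hf01 : ∀ t, f t ∈ Set.Icc (0:ℝ) 1)
    {σ : ℝ} (hσ : σ = ∫ t, f t ∂AddCircle.haarAddCircle)
    (hσ0 : 0 < σ) (hσ1 : σ < 1)
    {Ω : Type*} [MeasurableSpace Ω] {P : Measure Ω} [IsProbabilityMeasure P]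
    {ξ : ℤ → Ω → ℝ} (hξ_meas : ∀ n, Measurable (ξ n))
    (hξ01 : ∀ n ω, ξ n ω = 0 ∨ ξ n ω = 1)
    (hDPP : ∀ (k : ℕ) (n : Fin k → ℤ), Function.Injective n →
      ((∫ ω, ∏ i, ξ (n i) ω ∂P : ℝ) : ℂ) =
        Matrix.det (Matrix.of fun i j => fhat f (n i - n j)))
    (S : Finset ℤ) (w : ℤ → ℝ) {p : ℝ} (hp : 1 ≤ p) :
    eLpNorm (fun ω => ∑ i ∈ S, w i * (ξ i ω - σ)) (ENNReal.ofReal p) P ≤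
      ENNReal.ofReal (2 * Real.Gamma (p / 2 + 1) ^ (1 / p) * √(∑ i ∈ S, w i ^ 2)) := by
  have h1 := aux_subG hf_meas hf01 hσ hσ0 hσ1 hξ_meas hξ01 hDPP S (fun i => max (w i) 0)
    (Or.inl fun i => le_max_right _ _)
  have h2 := aux_subG hf_meas hf01 hσ hσ0 hσ1 hξ_meas hξ01 hDPP S (fun i => min (w i) 0)
    (Or.inr fun i => min_le_right _ _)
  have h3 := h1.add h2
  have e : (fun ω => ∑ i ∈ S, w i * (ξ i ω - σ)) =
      (fun ω => ∑ i ∈ S, max (w i) 0 * (ξ i ω - σ)) +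
        (fun ω => ∑ i ∈ S, min (w i) 0 * (ξ i ω - σ)) := by
    ext ω
    rw [Pi.add_apply, ← Finset.sum_add_distrib]
    refine Finset.sum_congr rfl fun i _ => ?_
    rw [← add_mul, max_add_min, add_zero]
  rw [e]
  refine (aux_norm h3 hp).trans (ENNReal.ofReal_le_ofReal ?_)
  have hG : 0 < Real.Gamma (p / 2 + 1) := Real.Gamma_pos_of_pos (by positivity)
  gcongr
  have hA : 0 ≤ ∑ i ∈ S, max (w i) 0 ^ 2 / 4 := Finset.sum_nonneg fun i _ => by positivity
  have hB : 0 ≤ ∑ i ∈ S, min (w i) 0 ^ 2 / 4 := Finset.sum_nonneg fun i _ => by positivity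
  have hAB : ∑ i ∈ S, w i ^ 2 =
      4 * (∑ i ∈ S, max (w i) 0 ^ 2 / 4 + ∑ i ∈ S, min (w i) 0 ^ 2 / 4) := by
    rw [← Finset.sum_add_distrib, Finset.mul_sum]
    refine Finset.sum_congr rfl fun i _ => ?_
    rcases le_total 0 (w i) with h | h <;> simp [h] <;> ring
  rw [hAB]
  push_cast
  rw [Real.coe_toNNReal _ hA, Real.coe_toNNReal _ hB]
  nlinarith [Real.sq_sqrt hA, Real.sq_sqrt hB,
    sq_nonneg (√(∑ i ∈ S, max (w i) 0 ^ 2 / 4) - √(∑ i ∈ S, min (w i) 0 ^ 2 / 4))]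

theorem stmt_14
    (f : AddCircle (1:ℝ) → ℝ) (hf_meas : Measurable f)
    (hf01 : ∀ t, f t ∈ Set.Icc (0:ℝ) 1)
    (σ : ℝ) (hσ : σ = ∫ t, f t ∂AddCircle.haarAddCircle)
    (hσ0 : 0 < σ) (hσ1 : σ < 1)
    {Ω : Type*} [MeasurableSpace Ω] (P : Measure Ω) [IsProbabilityMeasure P]
    (ξ : ℤ → Ω → ℝ) (hξ_meas : ∀ n, Measurable (ξ n))
    (hξ01 : ∀ n ω, ξ n ω = 0 ∨ ξ n ω = 1)
    (hDPP : ∀ (k : ℕ) (n : Fin k → ℤ), Function.Injective n →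
      ((∫ ω, ∏ i, ξ (n i) ω ∂P : ℝ) : ℂ) =
        Matrix.det (Matrix.of fun i j => fhat f (n i - n j))) :
    ∀ p : ℝ, 1 ≤ p → ∀ a : ℤ →₀ ℂ,
      eLpNorm (fun ω => ∑ n ∈ a.support, a n * ((ξ n ω : ℂ) - (σ:ℂ)))
          (ENNReal.ofReal p) P ≤
        ENNReal.ofReal (2 * Real.sqrt 2 * (Real.Gamma (p/2 + 1)) ^ (1/p) *
          Real.sqrt (∑ n ∈ a.support, ‖a n‖^2)) := by
  intro p hp a
  have hG : 0 < Real.Gamma (p / 2 + 1) := Real.Gamma_pos_of_pos (by positivity)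
  have h1 := aux_real hf_meas hf01 hσ hσ0 hσ1 hξ_meas hξ01 hDPP a.support (fun i => (a i).re) hp
  have h2 := aux_real hf_meas hf01 hσ hσ0 hσ1 hξ_meas hξ01 hDPP a.support (fun i => (a i).im) hp
  have hm : ∀ w : ℤ → ℝ, Measurable (fun ω => ∑ i ∈ a.support, w i * (ξ i ω - σ)) := fun w =>
    Finset.measurable_sum _ fun i _ => ((hξ_meas i).sub_const σ).const_mul _
  set R : Ω → ℝ := fun ω => ∑ i ∈ a.support, (a i).re * (ξ i ω - σ) with hR
  set J : Ω → ℝ := fun ω => ∑ i ∈ a.support, (a i).im * (ξ i ω - σ) with hJ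
  have hp1 : 1 ≤ ENNReal.ofReal p := by
    rw [← ENNReal.ofReal_one]; exact ENNReal.ofReal_le_ofReal hp
  have hpt : ∀ ω, ‖∑ n ∈ a.support, a n * ((ξ n ω : ℂ) - (σ:ℂ))‖ ≤ ‖|R ω| + |J ω|‖ := by
    intro ω
    rw [Real.norm_of_nonneg (by positivity)]
    refine (Complex.norm_le_abs_re_add_abs_im _).trans (le_of_eq ?_)
    rw [Complex.re_sum, Complex.im_sum]
    congr 2
    · refine Finset.sum_congr rfl fun i _ => ?_
      simp
    · refine Finset.sum_congr rfl fun i _ => ?_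
      simp
  calc _ ≤ eLpNorm (fun ω => |R ω| + |J ω|) (ENNReal.ofReal p) P := eLpNorm_mono hpt
    _ ≤ eLpNorm (fun ω => |R ω|) (ENNReal.ofReal p) P +
        eLpNorm (fun ω => |J ω|) (ENNReal.ofReal p) P :=
        eLpNorm_add_le (measurable_norm.comp (hm _)).aestronglyMeasurable
          (measurable_norm.comp (hm _)).aestronglyMeasurable hp1
    _ = eLpNorm R (ENNReal.ofReal p) P + eLpNorm J (ENNReal.ofReal p) P := by
        congr 1
        · exact eLpNorm_norm R
        · exact eLpNorm_norm J
    _ ≤ _ := add_le_add h1 h2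
    _ = _ := (ENNReal.ofReal_add (by positivity) (by positivity)).symm
    _ ≤ _ := by
        apply ENNReal.ofReal_le_ofReal
        set A := ∑ i ∈ a.support, (a i).re ^ 2 with hA
        set B := ∑ i ∈ a.support, (a i).im ^ 2 with hB
        have hA0 : 0 ≤ A := Finset.sum_nonneg fun i _ => by positivity
        have hB0 : 0 ≤ B := Finset.sum_nonneg fun i _ => by positivity
        have hAB : ∑ n ∈ a.support, ‖a n‖ ^ 2 = A + B := by
          rw [hA, hB, ← Finset.sum_add_distrib]
          refine Finset.sum_congr rfl fun i _ => ?_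
          rw [Complex.sq_norm, Complex.normSq_apply]; ring
        have hs : √A + √B ≤ √2 * √(A + B) := by
          rw [← Real.sqrt_mul (by norm_num)]
          apply Real.le_sqrt_of_sq_le
          nlinarith [Real.sq_sqrt hA0, Real.sq_sqrt hB0, sq_nonneg (√A - √B)]
        rw [hAB]
        calc _ = 2 * Real.Gamma (p / 2 + 1) ^ (1 / p) * (√A + √B) := by ring
          _ ≤ 2 * Real.Gamma (p / 2 + 1) ^ (1 / p) * (√2 * √(A + B)) := by gcongr
          _ = _ := by ring
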